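/- Let π be a permutation of ({0,1}ⁿ)ʷ, let 0 < α < 1 with q = 2^{αn} ∈ ℕ, let ε₁, ε₂, ε₃ > 0, and let U be a discrete q-box of dimension w. Suppose that for every discrete q-box V of dimension w, |π(U) ∩ V| < 2^{αnw(1 − ε₁ − ε₂ − ε₃ − 1/(αn))}. Then the set π(U) can be partitioned into pairwise disjoint sets C₁, …, C_w and R such that: (i) |R| ≤ (w·2^{−αnε₂} + 2^{−αnwε₃})·2^{αnw}; and (ii) for each i and each y ∈ {0,1}ⁿ, the slice |Cᵢ ∩ ({0,1}ⁿ)^{i−1} × {y} × ({0,1}ⁿ)^{w−i}| ≤ 2^{−(1+ε₁)αn}·|Cᵢ|. -/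

import Mathlib

open Finset

namespace Stmt6

/-- Bit strings of length `n`, i.e. `{0,1}ⁿ`. -/
abbrev Str (n : ℕ) := Fin n → Bool

/-- The space `({0,1}ⁿ)ʷ`. -/
abbrev Space (n w : ℕ) := Fin w → Str n

/-- A family `Us` of subsets of `{0,1}ⁿ` describes a discrete `q`-box of dimension `w`
(the box itself being the product set `Fintype.piFinset Us`). -/
def IsBox (n w q : ℕ) (Us : Fin w → Finset (Str n)) : Prop :=
  ∀ i, (Us i).card = q

/-- `|{x ∈ U : π(x) ∈ V}|` for the boxes `U = U₁ × ⋯ × U_w` and `V = V₁ × ⋯ × V_w`. -/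
def boxCount {n w : ℕ} (π : Space n w → Space n w)
    (Us Vs : Fin w → Finset (Str n)) : ℕ :=
  ((Fintype.piFinset Us).filter (fun x => π x ∈ Fintype.piFinset Vs)).card

/-- The coordinate values whose slice of `X` in coordinate `i` has more than `t` elements. -/
noncomputable def heavy {ι β : Type*} [Fintype β] [DecidableEq β]
    (X : Finset (ι → β)) (t : ℝ) (i : ι) : Finset β :=
  Finset.univ.filter (fun y => t < ((X.filter (fun v => v i = y)).card : ℝ))

lemma card_heavy_mul_le {ι β : Type*} [Fintype β] [DecidableEq β]
    (X : Finset (ι → β)) (t : ℝ) (i : ι) :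
    ((heavy X t i).card : ℝ) * t ≤ X.card := by
  have h₁ : ((heavy X t i).card : ℝ) * t
      ≤ ∑ y ∈ heavy X t i, ((X.filter (fun v => v i = y)).card : ℝ) := by
    rw [← nsmul_eq_mul]
    refine Finset.card_nsmul_le_sum _ _ _ fun y hy => ?_
    exact (Finset.mem_filter.1 hy).2.le
  refine h₁.trans ?_
  rw [Finset.card_eq_sum_card_fiberwise (f := fun v => v i) (t := Finset.univ)
    (fun _ _ => Finset.mem_coe.2 (Finset.mem_univ _))]
  push_cast
  exact Finset.sum_le_sum_of_subset_of_nonneg (Finset.subset_univ _) fun _ _ _ => by positivity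

/-- A finite set of size at most `k * q` is covered by `k` sets of size exactly `q`. -/
lemma exists_cover_card_eq {β : Type*} [Fintype β] [DecidableEq β] {q : ℕ}
    (hq : q ≤ Fintype.card β) (k : ℕ) (H : Finset β) (hH : H.card ≤ k * q) :
    ∃ B : Fin k → Finset β, (∀ j, (B j).card = q) ∧ ∀ y ∈ H, ∃ j, y ∈ B j := by
  induction k generalizing H with
  | zero =>
    have : H = ∅ := by simpa using hH
    exact ⟨fun _ => ∅, fun j => j.elim0, by simp [this]⟩
  | succ k ih =>
    obtain ⟨A, hA, hcov⟩ : ∃ A : Finset β, A.card = q ∧ (H \ A).card ≤ k * q := by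
      rcases le_total q H.card with h | h
      · obtain ⟨A, hAH, hA⟩ := Finset.exists_subset_card_eq h
        refine ⟨A, hA, ?_⟩
        rw [Finset.card_sdiff_of_subset hAH, hA]
        rw [add_mul, one_mul] at hH
        omega
      · obtain ⟨A, hHA, hA⟩ := Finset.exists_superset_card_eq h hq
        exact ⟨A, hA, by simp [Finset.sdiff_eq_empty_iff_subset.2 hHA]⟩
    obtain ⟨B, hB, hcovB⟩ := ih _ hcov
    refine ⟨Fin.cons A B, fun j => ?_, fun y hy => ?_⟩
    · refine Fin.cases ?_ (fun j => ?_) j <;> simp [hA, hB]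
    · by_cases hyA : y ∈ A
      · exact ⟨0, by simpa using hyA⟩
      · obtain ⟨j, hj⟩ := hcovB y (Finset.mem_sdiff.2 ⟨hy, hyA⟩)
        exact ⟨j.succ, by simpa using hj⟩

/-- If `X` meets every box of side `q` in at most `M` points, it meets a product of sets of size
at most `k * q` in at most `k ^ w * M` points. -/
lemma card_inter_piFinset_le {β : Type*} [Fintype β] [DecidableEq β] {w q k : ℕ} {M : ℝ}
    (hq : q ≤ Fintype.card β) (X : Finset (Fin w → β))
    (hX : ∀ V : Fin w → Finset β, (∀ i, (V i).card = q) →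
      ((X ∩ Fintype.piFinset V).card : ℝ) ≤ M)
    (H : Fin w → Finset β) (hH : ∀ i, (H i).card ≤ k * q) :
    ((X ∩ Fintype.piFinset H).card : ℝ) ≤ (k : ℝ) ^ w * M := by
  choose B hB hcov using fun i => exists_cover_card_eq hq k (H i) (hH i)
  have hsub : X ∩ Fintype.piFinset H ⊆ (Finset.univ : Finset (Fin w → Fin k)).biUnion
      (fun g => X ∩ Fintype.piFinset fun i => B i (g i)) := by
    intro v hv
    rw [Finset.mem_inter, Fintype.mem_piFinset] at hv
    choose g hg using fun i => hcov i (v i) (hv.2 i)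
    exact Finset.mem_biUnion.2 ⟨g, Finset.mem_univ _,
      Finset.mem_inter.2 ⟨hv.1, Fintype.mem_piFinset.2 hg⟩⟩
  calc ((X ∩ Fintype.piFinset H).card : ℝ)
      ≤ ∑ g : Fin w → Fin k, ((X ∩ Fintype.piFinset fun i => B i (g i)).card : ℝ) := by
        exact_mod_cast (Finset.card_le_card hsub).trans Finset.card_biUnion_le
    _ ≤ ∑ _g : Fin w → Fin k, M := Finset.sum_le_sum fun g _ => hX _ fun i => hB i (g i)
    _ = (k : ℝ) ^ w * M := by simp

/-- Sort the points of `X` by their first coordinate that is not heavy, and discard the classes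
with fewer than `T` points. -/
lemma exists_partition_of_heavy {β : Type*} [Fintype β] [DecidableEq β] {w : ℕ}
    (X : Finset (Fin w → β)) {c T : ℝ} (hc : 0 ≤ c) (hT : 0 ≤ T) :
    ∃ (C : Fin w → Finset (Fin w → β)) (R : Finset (Fin w → β)),
      (∀ i j, i ≠ j → Disjoint (C i) (C j)) ∧
      (∀ i, Disjoint (C i) R) ∧
      (Finset.univ.biUnion C) ∪ R = X ∧
      (R.card : ℝ) ≤ w * T + ((X ∩ Fintype.piFinset (heavy X (c * T))).card : ℝ) ∧
      (∀ i : Fin w, ∀ y : β,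
        (((C i).filter (fun v => v i = y)).card : ℝ) ≤ c * ((C i).card : ℝ)) := by
  classical
  set H := heavy X (c * T) with hH
  let D : Fin w → Finset (Fin w → β) := fun i =>
    X.filter (fun v => v i ∉ H i ∧ ∀ j < i, v j ∈ H j)
  let C : Fin w → Finset (Fin w → β) := fun i => if T ≤ ((D i).card : ℝ) then D i else ∅
  have hCD : ∀ i, C i ⊆ D i := fun i => by
    dsimp only [C]
    split_ifs <;> simp
  have hDX : ∀ i, D i ⊆ X := fun i => Finset.filter_subset _ _
  have hlt : ∀ i j, i < j → Disjoint (D i) (D j) := fun i j hij =>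
    Finset.disjoint_left.2 fun v hi hj =>
      (Finset.mem_filter.1 hi).2.1 ((Finset.mem_filter.1 hj).2.2 i hij)
  refine ⟨C, X \ Finset.univ.biUnion C, fun i j hij => ?_, fun i => ?_, ?_, ?_, fun i y => ?_⟩
  · refine Finset.disjoint_of_subset_left (hCD i) (Finset.disjoint_of_subset_right (hCD j) ?_)
    rcases lt_or_gt_of_ne hij with h | h
    · exact hlt i j h
    · exact (hlt j i h).symm
  · exact Finset.disjoint_of_subset_left (Finset.subset_biUnion_of_mem C (Finset.mem_univ i))
      Finset.disjoint_sdiff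
  · exact Finset.union_sdiff_of_subset
      (Finset.biUnion_subset.2 fun i _ => (hCD i).trans (hDX i))
  · have hsub : X \ Finset.univ.biUnion C ⊆
        (Finset.univ.biUnion fun i => D i \ C i) ∪ (X ∩ Fintype.piFinset H) := by
      intro v hv
      obtain ⟨hvX, hvC⟩ := Finset.mem_sdiff.1 hv
      by_cases hall : ∀ i, v i ∈ H i
      · exact Finset.mem_union_right _ (Finset.mem_inter.2 ⟨hvX, Fintype.mem_piFinset.2 hall⟩)
      · push Not at hall
        obtain ⟨i, hi, hmin⟩ := WellFounded.has_min (wellFounded_lt (α := Fin w))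
          {i | v i ∉ H i} hall
        refine Finset.mem_union_left _ (Finset.mem_biUnion.2 ⟨i, Finset.mem_univ _,
          Finset.mem_sdiff.2 ⟨Finset.mem_filter.2 ⟨hvX, hi, fun j hj => ?_⟩, fun h => ?_⟩⟩)
        · by_contra hjH
          exact hmin j hjH hj
        · exact hvC (Finset.mem_biUnion.2 ⟨i, Finset.mem_univ _, h⟩)
    have hsmall : ∀ i, ((D i \ C i).card : ℝ) ≤ T := fun i => by
      dsimp only [C]
      split_ifs with h
      · simpa using hT
      · simpa using (not_le.1 h).le
    calc ((X \ Finset.univ.biUnion C).card : ℝ)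
        ≤ ∑ i, ((D i \ C i).card : ℝ) + ((X ∩ Fintype.piFinset H).card : ℝ) := by
          exact_mod_cast (Finset.card_le_card hsub).trans ((Finset.card_union_le _ _).trans
            (Nat.add_le_add_right Finset.card_biUnion_le _))
      _ ≤ ∑ _i : Fin w, T + ((X ∩ Fintype.piFinset H).card : ℝ) := by
          gcongr with i
          exact hsmall i
      _ = _ := by simp
  · by_cases hbig : T ≤ ((D i).card : ℝ)
    · have hCi : C i = D i := if_pos hbig
      rw [hCi]
      by_cases hy : y ∈ H i
      · have : (D i).filter (fun v => v i = y) = ∅ :=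
          Finset.filter_eq_empty_iff.2 fun v hv hvy =>
            (Finset.mem_filter.1 hv).2.1 (hvy ▸ hy)
        rw [this]
        simp only [Finset.card_empty, Nat.cast_zero]
        positivity
      · have hlight : ((X.filter (fun v => v i = y)).card : ℝ) ≤ c * T := by
          simpa [hH, heavy] using hy
        calc (((D i).filter (fun v => v i = y)).card : ℝ)
            ≤ ((X.filter (fun v => v i = y)).card : ℝ) := by
              exact_mod_cast Finset.card_le_card (Finset.filter_subset_filter _ (hDX i))
          _ ≤ c * T := hlight
          _ ≤ c * (D i).card := by gcongr
    · have hCi : C i = ∅ := if_neg hbig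
      simp [hCi]

/-- Let `U` be a discrete `q`-box of dimension `w` (with `q = 2^{αn}`),
and suppose `|π(U) ∩ V| < 2^{αnw(1 − ε₁ − ε₂ − ε₃ − 1/(αn))}` for every discrete `q`-box
`V`. Then `π(U)` can be partitioned into pairwise disjoint sets `C₁, …, C_w` and `R` with
`|R| ≤ (w·2^{−αnε₂} + 2^{−αnwε₃})·2^{αnw}` and such that each slice of `Cᵢ` in
coordinate `i` has size at most `2^{−(1+ε₁)αn}·|Cᵢ|`. -/
theorem stmt6 (n w : ℕ) (π : Equiv.Perm (Space n w)) (α ε₁ ε₂ ε₃ : ℝ)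
    (hα0 : 0 < α) (hα1 : α < 1) (hε₁ : 0 < ε₁) (hε₂ : 0 < ε₂) (hε₃ : 0 < ε₃)
    (q : ℕ) (hq : (2 : ℝ) ^ (α * n) = q)
    (Us : Fin w → Finset (Str n)) (hU : IsBox n w q Us)
    (hcond : ∀ Vs : Fin w → Finset (Str n), IsBox n w q Vs →
      ((((Fintype.piFinset Us).image (⇑π)) ∩ Fintype.piFinset Vs).card : ℝ)
        < (2 : ℝ) ^ (α * n * w * (1 - ε₁ - ε₂ - ε₃ - 1 / (α * n)))) :
    ∃ (C : Fin w → Finset (Space n w)) (R : Finset (Space n w)),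
      (∀ i j, i ≠ j → Disjoint (C i) (C j)) ∧
      (∀ i, Disjoint (C i) R) ∧
      (Finset.univ.biUnion C) ∪ R = (Fintype.piFinset Us).image (⇑π) ∧
      ((R.card : ℝ)
        ≤ ((w : ℝ) * (2 : ℝ) ^ (-(α * n * ε₂)) + (2 : ℝ) ^ (-(α * n * w * ε₃)))
            * (2 : ℝ) ^ (α * n * w)) ∧
      (∀ i : Fin w, ∀ y : Str n,
        (((C i).filter (fun v => v i = y)).card : ℝ)
          ≤ (2 : ℝ) ^ (-((1 + ε₁) * α * n)) * ((C i).card : ℝ)) := by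
  set X := (Fintype.piFinset Us).image (⇑π) with hX
  have hXcard : X.card = q ^ w := by
    rw [hX, Finset.card_image_of_injective _ π.injective, Fintype.card_piFinset]
    simp [Finset.prod_congr rfl fun i _ => hU i]
  rcases Nat.eq_zero_or_pos n with rfl | hn
  · have hq1 : q = 1 := by
      have : (q : ℝ) = 1 := by rw [← hq]; simp
      exact_mod_cast this
    have hlt := hcond Us hU
    have hXU : X ∩ Fintype.piFinset Us = X := by
      refine Finset.inter_eq_left.2 fun v hv => ?_
      obtain ⟨u, hu, -⟩ := Finset.mem_image.1 hv
      rwa [Subsingleton.elim v u]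
    rw [hXU, hXcard, hq1] at hlt
    simp at hlt
  set N : ℝ := α * n with hN
  have hN0 : 0 < N := by positivity
  have hXreal : (X.card : ℝ) = (2 : ℝ) ^ (N * w) := by
    rw [hXcard, Nat.cast_pow, ← hq, ← Real.rpow_natCast, ← Real.rpow_mul zero_le_two]
  have hq2 : q ≤ Fintype.card (Str n) := by
    have : (q : ℝ) ≤ (2 : ℝ) ^ (n : ℝ) := by
      rw [← hq]
      exact Real.rpow_le_rpow_of_exponent_le one_le_two
        (mul_le_of_le_one_left (Nat.cast_nonneg n) hα1.le)
    rw [Real.rpow_natCast] at this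
    simpa using (by exact_mod_cast this : q ≤ 2 ^ n)
  set c : ℝ := (2 : ℝ) ^ (-((1 + ε₁) * α * n)) with hc
  set T : ℝ := (2 : ℝ) ^ (N * w - N * ε₂) with hT
  have hcT : c * T = (2 : ℝ) ^ (N * w - N * (1 + ε₁ + ε₂)) := by
    rw [hc, hT, ← Real.rpow_add two_pos]
    congr 1
    rw [hN]
    ring
  set s : ℝ := (2 : ℝ) ^ (N * (ε₁ + ε₂)) with hs
  have hs1 : 1 ≤ s := Real.one_le_rpow one_le_two (by positivity)
  have hheavy : ∀ i, (heavy X (c * T) i).card ≤ ⌈s⌉₊ * q := fun i => by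
    have h := card_heavy_mul_le X (c * T) i
    have hsplit : (X.card : ℝ) = s * q * (c * T) := by
      rw [hXreal, hcT, hs, ← hq, ← Real.rpow_add two_pos, ← Real.rpow_add two_pos]
      congr 1
      ring
    rw [hsplit] at h
    have h' : ((heavy X (c * T) i).card : ℝ) ≤ s * q := le_of_mul_le_mul_right h (by positivity)
    have h'' : s * q ≤ (⌈s⌉₊ : ℝ) * q := by
      gcongr
      exact Nat.le_ceil s
    exact_mod_cast h'.trans h''
  have hbox := card_inter_piFinset_le hq2 X (fun V hV => (hcond V hV).le) _ hheavy
  have hceil : (⌈s⌉₊ : ℝ) ≤ 2 * s := by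
    have := Nat.ceil_lt_add_one (zero_le_one.trans hs1)
    linarith
  obtain ⟨C, R, h₁, h₂, h₃, h₄, h₅⟩ :=
    exists_partition_of_heavy X (c := c) (T := T) (by positivity) (by positivity)
  refine ⟨C, R, h₁, h₂, h₃, h₄.trans ?_, h₅⟩
  have hT' : T = (2 : ℝ) ^ (-(N * ε₂)) * (2 : ℝ) ^ (N * w) := by
    rw [hT, ← Real.rpow_add two_pos]
    congr 1
    ring
  have hprod : (2 * s) ^ w * (2 : ℝ) ^ (N * w * (1 - ε₁ - ε₂ - ε₃ - 1 / N))
      = (2 : ℝ) ^ (-(N * w * ε₃)) * (2 : ℝ) ^ (N * w) := by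
    have h2s : 2 * s = (2 : ℝ) ^ (1 + N * (ε₁ + ε₂)) := by
      rw [Real.rpow_add two_pos, Real.rpow_one]
    rw [h2s, ← Real.rpow_natCast, ← Real.rpow_mul zero_le_two, ← Real.rpow_add two_pos,
      ← Real.rpow_add two_pos]
    congr 1
    field_simp
    ring
  rw [add_mul, ← hprod, mul_assoc, ← hT']
  gcongr
  exact hbox.trans (by gcongr)

end Stmt6
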